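/- Let Z be a complete separable metric space and H a separable normed vector space with continuous seminorms p and q. Let C, C₂, h, L ≥ 0 be constants such that: (i) ‖u‖ ≤ C · (p(u) + h · q(u)) for all u ∈ H; (ii) p(u) ≤ C₂ · q(u) for all u ∈ H; (iii) T : Z → H is Borel measurable with q(T z − T z') ≤ L · dist(z, z') and ‖T z − T z'‖ measurable in the appropriate sense for all z, z' ∈ Z. Let ν and Q be probability measures on Z with finite second moment, set P* := T_#ν, suppose W₂(Q, ν) ≤ ε_flow, and let z* ∈ Z with (∫ q(T(z*) − u)² dP*(u))^{1/2} ≤ ε_rec, with ε_flow, ε_rec ≥ 0 finite. Then W₂(T_#Q, P*) ≤ C · C₂ · L · ε_flow + C · h · (L · ε_flow + ε_rec). -/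

import Mathlib

open MeasureTheory ENNReal TopologicalSpace

/-- A coupling of two probability measures `P` and `Q` is a probability measure on the
product space whose first marginal is `P` and whose second marginal is `Q`. -/
def IsCoupling {α β : Type*} [MeasurableSpace α] [MeasurableSpace β]
    (π : Measure (α × β)) (P : Measure α) (Q : Measure β) : Prop :=
  IsProbabilityMeasure π ∧ π.map Prod.fst = P ∧ π.map Prod.snd = Q

/-- The 2-Wasserstein distance between two measures, defined as the infimum over all
couplings of the square root of the quadratic transport cost (valued in `[0,∞]`). -/
noncomputable def W2 {X : Type*} [MeasurableSpace X] [PseudoEMetricSpace X]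
    (P Q : Measure X) : ℝ≥0∞ :=
  ⨅ π ∈ {π : Measure (X × X) | IsCoupling π P Q},
    (∫⁻ x, edist x.1 x.2 ^ 2 ∂π) ^ (1 / 2 : ℝ)

/-- A measure on a metric space has finite second moment if
`∫ dist(x, x₀)² dP(x) < ∞` for some base point `x₀`. -/
def FiniteSecondMoment {X : Type*} [MeasurableSpace X] [PseudoEMetricSpace X]
    (P : Measure X) : Prop :=
  ∃ x₀ : X, ∫⁻ x, edist x x₀ ^ 2 ∂P < ∞

/-- The product measure is a coupling of two probability measures. -/
lemma isCoupling_prod {α β : Type*} [MeasurableSpace α] [MeasurableSpace β]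
    (P : Measure α) (Q : Measure β) [IsProbabilityMeasure P] [IsProbabilityMeasure Q] :
    IsCoupling (P.prod Q) P Q :=
  ⟨inferInstance, measurePreserving_fst.map_eq, measurePreserving_snd.map_eq⟩

/-- Couplings push forward along measurable maps. -/
lemma IsCoupling.map {α β α' β' : Type*} [MeasurableSpace α] [MeasurableSpace β]
    [MeasurableSpace α'] [MeasurableSpace β'] {π : Measure (α × β)} {P : Measure α}
    {Q : Measure β} (hπ : IsCoupling π P Q) {f : α → α'} {g : β → β'}
    (hf : Measurable f) (hg : Measurable g) :
    IsCoupling (π.map (Prod.map f g)) (P.map f) (Q.map g) := by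
  obtain ⟨hprob, rfl, rfl⟩ := hπ
  refine ⟨Measure.isProbabilityMeasure_map (hf.prodMap hg).aemeasurable, ?_, ?_⟩
  · rw [Measure.map_map measurable_fst (hf.prodMap hg), Measure.map_map hf measurable_fst]
    rfl
  · rw [Measure.map_map measurable_snd (hf.prodMap hg), Measure.map_map hg measurable_snd]
    rfl

/-- Pushing forward along a measurable `K`-Lipschitz map multiplies the 2-Wasserstein distance
by at most `K`. -/
lemma W2_map_le {X Y : Type*} [MeasurableSpace X] [PseudoEMetricSpace X]
    [MeasurableSpace Y] [PseudoEMetricSpace Y] {K : NNReal} {T : X → Y}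
    (hT : LipschitzWith K T) (hTm : Measurable T) (P Q : Measure X)
    [IsProbabilityMeasure P] [IsProbabilityMeasure Q] :
    W2 (P.map T) (Q.map T) ≤ K * W2 P Q := by
  have : Nonempty {π : Measure (X × X) | IsCoupling π P Q} := ⟨_, isCoupling_prod P Q⟩
  rw [W2, W2, iInf_subtype' (p := fun π => π ∈ {π : Measure (X × X) | IsCoupling π P Q}),
    ENNReal.mul_iInf' (fun h => absurd h coe_ne_top) (fun _ => this)]
  refine le_iInf fun ⟨π, hπ⟩ => (iInf₂_le (π.map (Prod.map T T)) (hπ.map hTm hTm)).trans ?_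
  calc (∫⁻ y, edist y.1 y.2 ^ 2 ∂(π.map (Prod.map T T))) ^ (1 / 2 : ℝ)
      ≤ (∫⁻ x, (K : ℝ≥0∞) ^ 2 * edist x.1 x.2 ^ 2 ∂π) ^ (1 / 2 : ℝ) := by
        gcongr
        refine (lintegral_map_le _ _).trans (lintegral_mono fun x => ?_)
        rw [← mul_pow]
        gcongr
        exact hT x.1 x.2
    _ = K * (∫⁻ x, edist x.1 x.2 ^ 2 ∂π) ^ (1 / 2 : ℝ) := by
        rw [lintegral_const_mul' _ _ (by finiteness),
          ENNReal.mul_rpow_of_nonneg _ _ (by norm_num), ← ENNReal.rpow_natCast,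
          ← ENNReal.rpow_mul]
        norm_num

/-- Abstract sensor-error theorem: under the sampling inequality
`‖u‖ ≤ C (p u + h q u)`, the embedding bound `p u ≤ C₂ q u`, `q`-Lipschitzness of the
decoder `T`, latent flow accuracy `W₂(Q, ν) ≤ ε_flow`, and `q`-reconstruction accuracy
`(∫ q(T(z*) − u)² dP*)^{1/2} ≤ ε_rec` (with `P* = T_#ν`), the posterior error satisfies
`W₂(T_#Q, P*) ≤ C C₂ L ε_flow + C h (L ε_flow + ε_rec)`. -/
theorem sensor_posterior_error {Z H : Type*}
    [MetricSpace Z] [CompleteSpace Z] [SeparableSpace Z]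
    [MeasurableSpace Z] [BorelSpace Z]
    [NormedAddCommGroup H] [NormedSpace ℝ H] [SeparableSpace H]
    [MeasurableSpace H] [BorelSpace H]
    (p q : Seminorm ℝ H) (hp : Continuous ⇑p) (hq : Continuous ⇑q)
    (C C₂ h L : ℝ) (hC : 0 ≤ C) (hC₂ : 0 ≤ C₂) (hh : 0 ≤ h) (hL : 0 ≤ L)
    (hnorm : ∀ u : H, ‖u‖ ≤ C * (p u + h * q u))
    (hpq : ∀ u : H, p u ≤ C₂ * q u)
    (T : Z → H) (hTm : Measurable T)
    (hT : ∀ z z' : Z, q (T z - T z') ≤ L * dist z z')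
    (ν Q : Measure Z) [IsProbabilityMeasure ν] [IsProbabilityMeasure Q]
    (hν : FiniteSecondMoment ν) (hQ : FiniteSecondMoment Q)
    (εflow εrec : ℝ) (hεflow : 0 ≤ εflow) (hεrec : 0 ≤ εrec)
    (hflow : W2 Q ν ≤ ENNReal.ofReal εflow)
    (zstar : Z)
    (hrec : (∫⁻ u, ENNReal.ofReal (q (T zstar - u)) ^ 2 ∂(ν.map T)) ^ (1 / 2 : ℝ) ≤
      ENNReal.ofReal εrec) :
    W2 (Q.map T) (ν.map T) ≤
      ENNReal.ofReal (C * C₂ * L * εflow + C * h * (L * εflow + εrec)) := by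
  have hK : 0 ≤ C * (C₂ + h) * L := by positivity
  have hlip : LipschitzWith (C * (C₂ + h) * L).toNNReal T := by
    refine LipschitzWith.of_dist_le_mul fun z z' => ?_
    rw [Real.coe_toNNReal _ hK, dist_eq_norm]
    calc ‖T z - T z'‖ ≤ C * (p (T z - T z') + h * q (T z - T z')) := hnorm _
      _ ≤ C * (C₂ * q (T z - T z') + h * q (T z - T z')) := by gcongr; exact hpq _
      _ = C * (C₂ + h) * q (T z - T z') := by ring
      _ ≤ C * (C₂ + h) * (L * dist z z') := by gcongr; exact hT z z'
      _ = C * (C₂ + h) * L * dist z z' := by ring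
  calc W2 (Q.map T) (ν.map T)
      ≤ ENNReal.ofReal (C * (C₂ + h) * L) * W2 Q ν := W2_map_le hlip hTm Q ν
    _ ≤ ENNReal.ofReal (C * (C₂ + h) * L) * ENNReal.ofReal εflow := by gcongr
    _ = ENNReal.ofReal (C * (C₂ + h) * L * εflow) := (ENNReal.ofReal_mul hK).symm
    _ ≤ ENNReal.ofReal (C * C₂ * L * εflow + C * h * (L * εflow + εrec)) := by
        refine ENNReal.ofReal_le_ofReal ?_
        have : 0 ≤ C * h * εrec := by positivity
        linarith
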